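/- Let θ ∈ C²(ℝ;ℝ), let r_θ(x₃) be the 3×3 rotation matrix with rows (cos θ(x₃), sin θ(x₃), 0), (−sin θ(x₃), cos θ(x₃), 0), (0,0,1), and define T_θ : ℝ³ → ℝ³ by T_θ(x) := r_θ(x₃) x. Then for every v ∈ C²(ℝ³;ℂ) and every x ∈ ℝ³: (Δ v)(T_θ(x)) = Δ_τ (v∘T_θ)(x) + ((θ̇(x₃)∂_φ + ∂₃)² (v∘T_θ))(x), where Δ is the Euclidean Laplacian on ℝ³. Equivalently, H_{θ̇}(v∘T_θ) = (−Δ v)∘T_θ, i.e. the twisted Laplacian is the pullback of −Δ under the twisting map. -/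

import Mathlib

open Real Set

/-- Partial derivative `∂_j` of a complex-valued function on `ℝ³`. -/
noncomputable def pd (j : Fin 3) (f : (Fin 3 → ℝ) → ℂ) (x : Fin 3 → ℝ) : ℂ :=
  fderiv ℝ f x (Pi.single j 1)

/-- The angular derivative `∂_φ := x₁∂₂ − x₂∂₁`. -/
noncomputable def dphi (f : (Fin 3 → ℝ) → ℂ) (x : Fin 3 → ℝ) : ℂ :=
  (x 0 : ℂ) * pd 1 f x - (x 1 : ℂ) * pd 0 f x

/-- The transverse Laplacian `Δ_τ := ∂₁² + ∂₂²`. -/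
noncomputable def deltaTau (f : (Fin 3 → ℝ) → ℂ) (x : Fin 3 → ℝ) : ℂ :=
  pd 0 (pd 0 f) x + pd 1 (pd 1 f) x

/-- `(θ̇∂_φ + ∂₃)² u = θ̇²∂_φ(∂_φ u) + θ̇∂_φ(∂₃u) + ∂₃(θ̇∂_φ u) + ∂₃(∂₃u)`. -/
noncomputable def twistSq (b : ℝ → ℝ) (u : (Fin 3 → ℝ) → ℂ) (x : Fin 3 → ℝ) : ℂ :=
  (b (x 2) : ℂ)^2 * dphi (dphi u) x + (b (x 2) : ℂ) * dphi (pd 2 u) x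
    + pd 2 (fun y => (b (y 2) : ℂ) * dphi u y) x + pd 2 (pd 2 u) x

/-- The twisted Laplacian `H_{θ̇} u := −Δ_τ u − (θ̇∂_φ + ∂₃)² u`. -/
noncomputable def Hop (b : ℝ → ℝ) (u : (Fin 3 → ℝ) → ℂ) (x : Fin 3 → ℝ) : ℂ :=
  - deltaTau u x - twistSq b u x

/-- The twisting map `T_θ(x) := r_θ(x₃) x`. -/
noncomputable def Tmap (θ : ℝ → ℝ) (x : Fin 3 → ℝ) : Fin 3 → ℝ :=
  ![Real.cos (θ (x 2)) * x 0 + Real.sin (θ (x 2)) * x 1,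
    -Real.sin (θ (x 2)) * x 0 + Real.cos (θ (x 2)) * x 1,
    x 2]

lemma differentiable_ofReal_comp_coord {a : ℝ → ℝ} (ha : Differentiable ℝ a) :
    Differentiable ℝ (fun y : Fin 3 → ℝ => (a (y 2) : ℂ)) :=
  Complex.ofRealCLM.differentiable.comp (ha.comp (differentiable_apply 2))

lemma pd_add {j : Fin 3} {f g : (Fin 3 → ℝ) → ℂ} {x : Fin 3 → ℝ}
    (hf : DifferentiableAt ℝ f x) (hg : DifferentiableAt ℝ g x) :
    pd j (fun y => f y + g y) x = pd j f x + pd j g x := by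
  simp only [pd, fderiv_fun_add hf hg, add_apply]

lemma pd_sub {j : Fin 3} {f g : (Fin 3 → ℝ) → ℂ} {x : Fin 3 → ℝ}
    (hf : DifferentiableAt ℝ f x) (hg : DifferentiableAt ℝ g x) :
    pd j (fun y => f y - g y) x = pd j f x - pd j g x := by
  simp only [pd, fderiv_fun_sub hf hg, sub_apply]

/-- Functions of `x₃` alone are constants for the transverse derivatives. -/
lemma pd_ofReal_comp_coord_mul {j : Fin 3} (hj : j ≠ 2) {a : ℝ → ℝ} (ha : Differentiable ℝ a)
    {f : (Fin 3 → ℝ) → ℂ} {x : Fin 3 → ℝ} (hf : DifferentiableAt ℝ f x) :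
    pd j (fun y => (a (y 2) : ℂ) * f y) x = (a (x 2) : ℂ) * pd j f x := by
  have h0 : fderiv ℝ (fun y : Fin 3 → ℝ => (a (y 2) : ℂ)) x (Pi.single j 1) = 0 := by
    have h1 : HasFDerivAt (fun y : Fin 3 → ℝ => y 2)
        (ContinuousLinearMap.proj (R := ℝ) (φ := fun _ : Fin 3 => ℝ) 2) x := hasFDerivAt_apply 2 x
    have h2 := (ha (x 2)).hasDerivAt.comp_hasFDerivAt x h1
    have h3 := Complex.ofRealCLM.hasFDerivAt.comp x h2
    have h4 : fderiv ℝ (fun y : Fin 3 → ℝ => (a (y 2) : ℂ)) x = _ := h3.fderiv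
    rw [h4]
    simp [Pi.single_eq_of_ne hj.symm]
  simp only [pd]
  rw [fderiv_fun_mul (differentiable_ofReal_comp_coord ha x) hf]
  simp [h0]

lemma ContDiff.pd {v : (Fin 3 → ℝ) → ℂ} (hv : ContDiff ℝ 2 v) (j : Fin 3) :
    ContDiff ℝ 1 (pd j v) :=
  (hv.fderiv_right (m := 1) (by norm_num)).clm_apply contDiff_const

lemma contDiff_Tmap {θ : ℝ → ℝ} (hθ : ContDiff ℝ 2 θ) : ContDiff ℝ 2 (Tmap θ) := by
  rw [contDiff_pi]
  intro i
  have h (i : Fin 3) : ContDiff ℝ 2 (fun y : Fin 3 → ℝ => y i) := contDiff_apply ℝ ℝ i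
  have hc := Real.contDiff_cos.comp (hθ.comp (h 2))
  have hs := Real.contDiff_sin.comp (hθ.comp (h 2))
  fin_cases i
  · exact (hc.mul (h 0)).add (hs.mul (h 1))
  · exact (hs.neg.mul (h 0)).add (hc.mul (h 1))
  · exact h 2

lemma fderiv_apply_eq_sum_pd (w : (Fin 3 → ℝ) → ℂ) (p h : Fin 3 → ℝ) :
    fderiv ℝ w p h = ∑ i, (h i : ℂ) * pd i w p := by
  conv_lhs => rw [← Finset.univ_sum_single h]
  rw [map_sum]
  refine Finset.sum_congr rfl fun i _ => ?_
  have : Pi.single i (h i) = h i • (Pi.single i 1 : Fin 3 → ℝ) := by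
    rw [← Pi.single_smul, smul_eq_mul, mul_one]
  rw [this, map_smul, pd, Complex.real_smul]

lemma differentiable_Tmap {θ : ℝ → ℝ} (hθ : Differentiable ℝ θ) : Differentiable ℝ (Tmap θ) := by
  rw [differentiable_pi]
  intro i
  have h (i : Fin 3) : Differentiable ℝ (fun y : Fin 3 → ℝ => y i) := differentiable_apply i
  have ht : Differentiable ℝ (fun y : Fin 3 → ℝ => θ (y 2)) := hθ.comp (h 2)
  fin_cases i
  · exact (ht.cos.mul (h 0)).add (ht.sin.mul (h 1))
  · exact (ht.sin.neg.mul (h 0)).add (ht.cos.mul (h 1))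
  · exact h 2

lemma fderiv_Tmap {θ : ℝ → ℝ} (hθ : Differentiable ℝ θ) (x h : Fin 3 → ℝ) :
    fderiv ℝ (Tmap θ) x h =
      ![Real.cos (θ (x 2)) * h 0 + Real.sin (θ (x 2)) * h 1 + deriv θ (x 2) * h 2 * Tmap θ x 1,
        -Real.sin (θ (x 2)) * h 0 + Real.cos (θ (x 2)) * h 1 - deriv θ (x 2) * h 2 * Tmap θ x 0,
        h 2] := by
  have hp (i : Fin 3) : HasFDerivAt (fun y : Fin 3 → ℝ => y i)
        (ContinuousLinearMap.proj (R := ℝ) (φ := fun _ : Fin 3 => ℝ) i) x := hasFDerivAt_apply i x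
  have ht : HasFDerivAt (fun y : Fin 3 → ℝ => θ (y 2)) _ x :=
    (hθ (x 2)).hasDerivAt.comp_hasFDerivAt x (hp 2)
  have h0 := (ht.cos.mul (hp 0)).add (ht.sin.mul (hp 1))
  have h1 := (ht.sin.neg.mul (hp 0)).add (ht.cos.mul (hp 1))
  have hT := hasFDerivAt_pi'.1 (differentiable_Tmap hθ x).hasFDerivAt
  ext i
  fin_cases i
  · have e := DFunLike.congr_fun ((hT 0).unique h0) h
    simp at e
    simp [Tmap, e]
    ring
  · have e := DFunLike.congr_fun ((hT 1).unique h1) h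
    simp at e
    simp [Tmap, e]
    ring
  · have e := DFunLike.congr_fun ((hT 2).unique (hp 2)) h
    simpa using e

lemma pd_comp_Tmap {θ : ℝ → ℝ} (hθ : Differentiable ℝ θ) {w : (Fin 3 → ℝ) → ℂ}
    (hw : Differentiable ℝ w) (x : Fin 3 → ℝ) (j : Fin 3) :
    pd j (fun y => w (Tmap θ y)) x =
      ∑ i, (fderiv ℝ (Tmap θ) x (Pi.single j 1) i : ℂ) * pd i w (Tmap θ x) := by
  rw [← fderiv_apply_eq_sum_pd, pd]
  have := fderiv_comp x (hw (Tmap θ x)) (differentiable_Tmap hθ x)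
  exact congrArg (fun L => L (Pi.single j 1)) this

lemma pd_zero_comp_Tmap {θ : ℝ → ℝ} (hθ : Differentiable ℝ θ) {w : (Fin 3 → ℝ) → ℂ}
    (hw : Differentiable ℝ w) (x : Fin 3 → ℝ) :
    pd 0 (fun y => w (Tmap θ y)) x =
      (Real.cos (θ (x 2)) : ℂ) * pd 0 w (Tmap θ x)
        - (Real.sin (θ (x 2)) : ℂ) * pd 1 w (Tmap θ x) := by
  simp [pd_comp_Tmap hθ hw, fderiv_Tmap hθ, Fin.sum_univ_three]
  ring

lemma pd_one_comp_Tmap {θ : ℝ → ℝ} (hθ : Differentiable ℝ θ) {w : (Fin 3 → ℝ) → ℂ}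
    (hw : Differentiable ℝ w) (x : Fin 3 → ℝ) :
    pd 1 (fun y => w (Tmap θ y)) x =
      (Real.sin (θ (x 2)) : ℂ) * pd 0 w (Tmap θ x)
        + (Real.cos (θ (x 2)) : ℂ) * pd 1 w (Tmap θ x) := by
  simp [pd_comp_Tmap hθ hw, fderiv_Tmap hθ, Fin.sum_univ_three]

/-- The twisted longitudinal derivative `θ̇∂_φ + ∂₃` is the pullback of `∂₃`. -/
lemma twist_comp_Tmap {θ : ℝ → ℝ} (hθ : Differentiable ℝ θ) {w : (Fin 3 → ℝ) → ℂ}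
    (hw : Differentiable ℝ w) (x : Fin 3 → ℝ) :
    ((deriv θ (x 2) : ℝ) : ℂ) * dphi (fun y => w (Tmap θ y)) x + pd 2 (fun y => w (Tmap θ y)) x =
      pd 2 w (Tmap θ x) := by
  rw [dphi, pd_zero_comp_Tmap hθ hw, pd_one_comp_Tmap hθ hw, pd_comp_Tmap hθ hw]
  simp [fderiv_Tmap hθ, Fin.sum_univ_three, Tmap]
  ring

lemma ContDiff.dphi {u : (Fin 3 → ℝ) → ℂ} (hu : ContDiff ℝ 2 u) : ContDiff ℝ 1 (dphi u) := by
  have h (i : Fin 3) : ContDiff ℝ 1 (fun y : Fin 3 → ℝ => (y i : ℂ)) :=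
    Complex.ofRealCLM.contDiff.comp (contDiff_apply ℝ ℝ i)
  exact ((h 0).mul (hu.pd 1)).sub ((h 1).mul (hu.pd 0))

/-- `twistSq b` is the square of the first-order operator `b∂_φ + ∂₃`. -/
lemma twistSq_eq {b : ℝ → ℝ} (hb : Differentiable ℝ b) {u : (Fin 3 → ℝ) → ℂ}
    (hu : ContDiff ℝ 2 u) (x : Fin 3 → ℝ) :
    twistSq b u x =
      (b (x 2) : ℂ) * dphi (fun y => (b (y 2) : ℂ) * dphi u y + pd 2 u y) x
        + pd 2 (fun y => (b (y 2) : ℂ) * dphi u y + pd 2 u y) x := by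
  have h1 : DifferentiableAt ℝ (dphi u) x := hu.dphi.differentiable (by norm_num) x
  have h2 : DifferentiableAt ℝ (pd 2 u) x := (hu.pd 2).differentiable (by norm_num) x
  have h3 : DifferentiableAt ℝ (fun y => (b (y 2) : ℂ) * dphi u y) x :=
    (differentiable_ofReal_comp_coord hb x).mul h1
  rw [twistSq, pd_add h3 h2]
  simp only [dphi.eq_1 (fun y => (b (y 2) : ℂ) * dphi u y + pd 2 u y), pd_add h3 h2,
    pd_ofReal_comp_coord_mul (show (0 : Fin 3) ≠ 2 by decide) hb h1,
    pd_ofReal_comp_coord_mul (show (1 : Fin 3) ≠ 2 by decide) hb h1,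
    dphi.eq_1 (dphi u), dphi.eq_1 (pd 2 u)]
  ring

lemma twistSq_comp_Tmap {θ : ℝ → ℝ} (hθ : ContDiff ℝ 2 θ) {v : (Fin 3 → ℝ) → ℂ}
    (hv : ContDiff ℝ 2 v) (x : Fin 3 → ℝ) :
    twistSq (deriv θ) (fun y => v (Tmap θ y)) x = pd 2 (pd 2 v) (Tmap θ x) := by
  have hθ1 : Differentiable ℝ θ := hθ.differentiable (by norm_num)
  have hb : Differentiable ℝ (deriv θ) := hθ.differentiable_deriv_two
  rw [twistSq_eq (u := fun y => v (Tmap θ y)) hb (hv.comp (contDiff_Tmap hθ))]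
  simp only [twist_comp_Tmap hθ1 (hv.differentiable (by norm_num))]
  exact twist_comp_Tmap hθ1 ((hv.pd 2).differentiable (by norm_num)) x

lemma deltaTau_comp_Tmap {θ : ℝ → ℝ} (hθ : ContDiff ℝ 2 θ) {v : (Fin 3 → ℝ) → ℂ}
    (hv : ContDiff ℝ 2 v) (x : Fin 3 → ℝ) :
    deltaTau (fun y => v (Tmap θ y)) x =
      pd 0 (pd 0 v) (Tmap θ x) + pd 1 (pd 1 v) (Tmap θ x) := by
  have hθ1 : Differentiable ℝ θ := hθ.differentiable (by norm_num)
  have hv1 : Differentiable ℝ v := hv.differentiable (by norm_num)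
  have hc : Differentiable ℝ (fun t => Real.cos (θ t)) := hθ1.cos
  have hs : Differentiable ℝ (fun t => Real.sin (θ t)) := hθ1.sin
  have hpd (j : Fin 3) : Differentiable ℝ (pd j v) := (hv.pd j).differentiable (by norm_num)
  have hg (j : Fin 3) : DifferentiableAt ℝ (fun y => pd j v (Tmap θ y)) x :=
    ((hpd j).comp (differentiable_Tmap hθ1)) x
  have hcg (j : Fin 3) :
      DifferentiableAt ℝ (fun y => (Real.cos (θ (y 2)) : ℂ) * pd j v (Tmap θ y)) x :=
    (differentiable_ofReal_comp_coord hc x).mul (hg j)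
  have hsg (j : Fin 3) :
      DifferentiableAt ℝ (fun y => (Real.sin (θ (y 2)) : ℂ) * pd j v (Tmap θ y)) x :=
    (differentiable_ofReal_comp_coord hs x).mul (hg j)
  have e0 : pd 0 (fun y => v (Tmap θ y)) = fun y => _ :=
    funext (pd_zero_comp_Tmap hθ1 hv1)
  have e1 : pd 1 (fun y => v (Tmap θ y)) = fun y => _ :=
    funext (pd_one_comp_Tmap hθ1 hv1)
  have n0 : (0 : Fin 3) ≠ 2 := by decide
  have n1 : (1 : Fin 3) ≠ 2 := by decide
  rw [deltaTau, e0, e1, pd_sub (hcg 0) (hsg 1), pd_add (hsg 0) (hcg 1),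
    pd_ofReal_comp_coord_mul n0 hc (hg 0), pd_ofReal_comp_coord_mul n0 hs (hg 1),
    pd_ofReal_comp_coord_mul n1 hs (hg 0), pd_ofReal_comp_coord_mul n1 hc (hg 1)]
  simp only [pd_zero_comp_Tmap hθ1 (hpd _), pd_one_comp_Tmap hθ1 (hpd _)]
  have hcs : (Real.cos (θ (x 2)) : ℂ) ^ 2 + (Real.sin (θ (x 2)) : ℂ) ^ 2 = 1 := by
    exact_mod_cast Real.cos_sq_add_sin_sq (θ (x 2))
  linear_combination (pd 0 (pd 0 v) (Tmap θ x) + pd 1 (pd 1 v) (Tmap θ x)) * hcs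

/-- the twisted Laplacian is the pullback of the Euclidean
Laplacian under the twisting map:
`(Δv)∘T_θ = Δ_τ(v∘T_θ) + (θ̇∂_φ+∂₃)²(v∘T_θ)`, i.e. `H_{θ̇}(v∘T_θ) = (−Δv)∘T_θ`. -/
theorem stmt10 (θ : ℝ → ℝ) (hθ : ContDiff ℝ 2 θ)
    (v : (Fin 3 → ℝ) → ℂ) (hv : ContDiff ℝ 2 v) (x : Fin 3 → ℝ) :
    (∑ i, pd i (pd i v) (Tmap θ x))
        = deltaTau (fun y => v (Tmap θ y)) x
          + twistSq (deriv θ) (fun y => v (Tmap θ y)) x ∧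
    Hop (deriv θ) (fun y => v (Tmap θ y)) x
        = - ∑ i, pd i (pd i v) (Tmap θ x) := by
  have h : ∑ i, pd i (pd i v) (Tmap θ x) =
      deltaTau (fun y => v (Tmap θ y)) x + twistSq (deriv θ) (fun y => v (Tmap θ y)) x := by
    rw [deltaTau_comp_Tmap hθ hv, twistSq_comp_Tmap hθ hv, Fin.sum_univ_three]
  refine ⟨h, ?_⟩
  rw [h, Hop]
  ring
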